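/- arXiv:1610.02516 — 3 statements merged into one kernel-verified Lean document; each statement's English description precedes it below -/
import Mathlib

section
/- Let N be a positive integer, let a > 0 and b > 0 be real numbers, and let w_1, …, w_N be real numbers with 0 ≤ w_n ≤ 1 for all n. Fix I ∈ {1, …, N} and define f_n = 1 if w_n ≤ w̃_I and f_n = 0 otherwise. Then for every choice of f'_1, …, f'_N ∈ {0,1} satisfying ∑_{n=1}^N (a·w_n + b)·f_n = ∑_{n=1}^N (a·w_n + b)·f'_n, one has ∑_{n=1}^N w_n·f_n ≤ ∑_{n=1}^N w_n·f'_n. (Paper's Lemma 3.) -/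
/-- Paper's Lemma 3: the threshold selection `f n = 1 ↔ w n ≤ w̃ I` minimizes
`∑ w n * f n` among all 0/1 selections `f'` achieving the same value of
`∑ (a * w n + b) * f' n`.  Here `ws` is the ascending sort of `w`
(witnessed by the permutation `σ`). -/
theorem stmt_0 (N : ℕ) (hN : 0 < N) (a b : ℝ) (ha : 0 < a) (hb : 0 < b)
    (w ws : Fin N → ℝ) (hw : ∀ n, 0 ≤ w n ∧ w n ≤ 1)
    (σ : Equiv.Perm (Fin N)) (hσ : ∀ n, ws n = w (σ n)) (hmono : Monotone ws)
    (I : Fin N)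
    (f : Fin N → ℝ) (hf : ∀ n, f n = if w n ≤ ws I then 1 else 0)
    (f' : Fin N → ℝ) (hf' : ∀ n, f' n = 0 ∨ f' n = 1)
    (hsum : ∑ n, (a * w n + b) * f n = ∑ n, (a * w n + b) * f' n) :
    ∑ n, w n * f n ≤ ∑ n, w n * f' n := by
  have ht : 0 ≤ ws I := hσ I ▸ (hw (σ I)).1
  have hle : ∑ n, w n * (f n - f' n) ≤ ws I * ∑ n, (f n - f' n) := by
    rw [Finset.mul_sum]
    refine Finset.sum_le_sum fun n _ => ?_
    rw [hf n]
    split_ifs with h <;> rcases hf' n with h' | h' <;> rw [h'] <;> linarith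
  have hbal : a * ∑ n, w n * (f n - f' n) + b * ∑ n, (f n - f' n) = 0 := by
    rw [← sub_eq_zero, ← Finset.sum_sub_distrib] at hsum
    rw [Finset.mul_sum, Finset.mul_sum, ← Finset.sum_add_distrib, ← hsum]
    exact Finset.sum_congr rfl fun n _ => by ring
  have hdiff : ∑ n, w n * (f n - f' n) = ∑ n, w n * f n - ∑ n, w n * f' n := by
    simp only [mul_sub, Finset.sum_sub_distrib]
  rw [hdiff] at hle hbal
  have hpos : 0 < b + ws I * a := by positivity
  have hprod : (b + ws I * a) * (∑ n, w n * f n - ∑ n, w n * f' n) ≤ 0 := by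
    linear_combination b * hle + ws I * hbal
  exact sub_nonpos.mp (nonpos_of_mul_nonpos_right hprod hpos)
end

section
/- Let N be a positive integer, let a > 0 and b > 0 be real numbers, and let w_1, …, w_N be real numbers with 0 ≤ w_n ≤ 1 for all n. Fix I ∈ {1, …, N}, define f_n = 1 if w_n ≤ w̃_I and f_n = 0 otherwise, and let k = #{n : f_n = 1}. If f'_1, …, f'_N ∈ {0,1} satisfy ∑_{n=1}^N (a·w_n + b)·f'_n = ∑_{n=1}^N (a·w_n + b)·f_n, then the number of indices n with f'_n = 1 is at most k. (The cardinality bound used in the proof of the paper's Lemma 3.) -/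
/-- Cardinality bound from the proof of the paper's Lemma 3: any 0/1 selection
`f'` achieving the same value of `∑ (a * w n + b) * f' n` as the threshold
selection `f n = 1 ↔ w n ≤ w̃ I` selects at most `k` indices, where `k` is the
number of indices selected by the threshold solution. -/
theorem stmt_3 (N : ℕ) (hN : 0 < N) (a b : ℝ) (ha : 0 < a) (hb : 0 < b)
    (w ws : Fin N → ℝ) (hw : ∀ n, 0 ≤ w n ∧ w n ≤ 1)
    (σ : Equiv.Perm (Fin N)) (hσ : ∀ n, ws n = w (σ n)) (hmono : Monotone ws)
    (I : Fin N)
    (f : Fin N → ℝ) (hf : ∀ n, f n = if w n ≤ ws I then 1 else 0)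
    (k : ℕ) (hk : k = (Finset.univ.filter (fun n : Fin N => w n ≤ ws I)).card)
    (f' : Fin N → ℝ) (hf' : ∀ n, f' n = 0 ∨ f' n = 1)
    (hsum : ∑ n, (a * w n + b) * f' n = ∑ n, (a * w n + b) * f n) :
    (Finset.univ.filter (fun n : Fin N => f' n = 1)).card ≤ k := by
  set c : ℝ := a * ws I + b with hc
  have hcpos : 0 < c := by
    have h0 : 0 ≤ ws I := hσ I ▸ (hw (σ I)).1
    positivity
  have hterm (n : Fin N) : (a * w n + b - c) * f n ≤ (a * w n + b - c) * f' n := by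
    rw [hf n]
    split_ifs with h <;> rcases hf' n with h' | h' <;> rw [h'] <;> nlinarith
  have hle : c * ∑ n, f' n ≤ c * ∑ n, f n := by
    have h := Finset.sum_le_sum fun n (_ : n ∈ Finset.univ) => hterm n
    simp only [sub_mul, Finset.sum_sub_distrib, ← Finset.mul_sum] at h
    linarith
  have hcard : ∑ n, f n = k := by
    simp [hf, hk]
  have hcard' : ∑ n, f' n = (Finset.univ.filter fun n : Fin N => f' n = 1).card := by
    rw [← Finset.sum_boole]
    refine Finset.sum_congr rfl fun n _ => ?_
    rcases hf' n with h | h <;> simp [h]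
  rw [hcard, hcard'] at hle
  exact_mod_cast le_of_mul_le_mul_left hle hcpos
end

section
/- Let N be a positive integer, let w_1, …, w_N be nonnegative real numbers, let h_1, h_2, h_3 be real numbers, and set p(g) = h_1·g^3 + h_2·g^2 + h_3·g for g ∈ {0,1,2,3}; assume 0 < p(1) < p(2) < p(3). Let c > 0 and let T be a real number with T ≤ 3c. Then the minimum of ∑_{n=1}^N w_n · p(g_n) over all assignments g_1, …, g_N ∈ {0,1,2,3} satisfying (c/N)·∑_{n=1}^N g_n ≥ T equals the minimum, over all nonnegative integers N_1, N_2, N_3 with N_1 + N_2 + N_3 ≤ N and (c/N)·(N_1 + 2·N_2 + 3·N_3) ≥ T, of p(3)·∑_{n=1}^{N_3} w̃_n + p(2)·∑_{n=N_3+1}^{N_3+N_2} w̃_n + p(1)·∑_{n=N_3+N_2+1}^{N_3+N_2+N_1} w̃_n. (Both feasible sets are finite and nonempty, the first containing g ≡ 3 and the second containing (N_1,N_2,N_3) = (0,0,N).) (Paper's Lemma 4: the nonlinear integer program (20-b) is equivalent to the linear integer program (27).) -/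
/-- The nonincreasing function taking the value `3` on `N3` indices, then `2` on `N2` indices,
then `1` on `N1` indices, and `0` afterwards. -/
def blockProfile (N1 N2 N3 n : ℕ) : ℕ :=
  if n < N3 then 3 else if n < N3 + N2 then 2 else if n < N3 + N2 + N1 then 1 else 0

lemma blockProfile_le (N1 N2 N3 n : ℕ) : blockProfile N1 N2 N3 n ≤ 3 := by
  unfold blockProfile
  split_ifs <;> omega

lemma sum_mul_blockProfile {N : ℕ} (N1 N2 N3 : ℕ) (w : Fin N → ℝ) (q : ℕ → ℝ) (hq : q 0 = 0) :
    ∑ n, w n * q (blockProfile N1 N2 N3 n) =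
      q 3 * (∑ n ∈ Finset.univ.filter (fun n : Fin N => (n : ℕ) < N3), w n)
        + q 2 * (∑ n ∈ Finset.univ.filter
            (fun n : Fin N => N3 ≤ (n : ℕ) ∧ (n : ℕ) < N3 + N2), w n)
        + q 1 * (∑ n ∈ Finset.univ.filter
            (fun n : Fin N => N3 + N2 ≤ (n : ℕ) ∧ (n : ℕ) < N3 + N2 + N1), w n) := by
  simp only [Finset.sum_filter, Finset.mul_sum, ← Finset.sum_add_distrib]
  refine Finset.sum_congr rfl fun n _ => ?_
  unfold blockProfile
  split_ifs <;> first | omega | (simp [hq, mul_comm])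

lemma sum_ite_val_lt {N K : ℕ} (hK : K ≤ N) :
    ∑ n : Fin N, (if (n : ℕ) < K then 1 else 0) = K := by
  simp [Fin.card_filter_val_lt, hK]

lemma sum_blockProfile {N N1 N2 N3 : ℕ} (h : N1 + N2 + N3 ≤ N) :
    ∑ n : Fin N, blockProfile N1 N2 N3 n = N1 + 2 * N2 + 3 * N3 := by
  have key : ∀ n : Fin N, blockProfile N1 N2 N3 n = (if (n : ℕ) < N3 then 1 else 0)
      + (if (n : ℕ) < N3 + N2 then 1 else 0) + (if (n : ℕ) < N3 + N2 + N1 then 1 else 0) := by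
    intro n
    unfold blockProfile
    split_ifs <;> omega
  simp only [key, Finset.sum_add_distrib]
  rw [sum_ite_val_lt (by omega), sum_ite_val_lt (by omega), sum_ite_val_lt (by omega)]
  ring

lemma Antitone.le_apply_iff_val_lt_card {N : ℕ} {f : Fin N → ℕ} (hf : Antitone f) (k : ℕ)
    (n : Fin N) : k ≤ f n ↔ (n : ℕ) < (Finset.univ.filter fun m => k ≤ f m).card := by
  constructor
  · intro h
    have hsub : Finset.Iic n ⊆ Finset.univ.filter fun m => k ≤ f m := fun m hm => by
      simpa using h.trans (hf (Finset.mem_Iic.1 hm))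
    have := Finset.card_le_card hsub
    rw [Fin.card_Iic] at this
    omega
  · intro h
    by_contra hn
    have hsub : (Finset.univ.filter fun m => k ≤ f m) ⊆ Finset.Iio n := fun m hm => by
      rw [Finset.mem_Iio]
      by_contra hmn
      exact hn ((Finset.mem_filter.1 hm).2.trans (hf (not_lt.1 hmn)))
    have := Finset.card_le_card hsub
    rw [Fin.card_Iio] at this
    omega

lemma Antitone.exists_eq_blockProfile {N : ℕ} {f : Fin N → ℕ} (hf : Antitone f)
    (h3 : ∀ n, f n ≤ 3) :
    ∃ N1 N2 N3, N1 + N2 + N3 ≤ N ∧ ∀ n : Fin N, f n = blockProfile N1 N2 N3 n := by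
  let m : ℕ → ℕ := fun k => (Finset.univ.filter fun n => k ≤ f n).card
  have hm : Antitone m := fun a b hab => Finset.card_le_card fun n hn => by
    simpa using hab.trans (Finset.mem_filter.1 hn).2
  have h12 : m 2 ≤ m 1 := hm (by norm_num)
  have h23 : m 3 ≤ m 2 := hm (by norm_num)
  have hN : m 1 ≤ N := (Finset.card_le_univ _).trans_eq (Fintype.card_fin N)
  refine ⟨m 1 - m 2, m 2 - m 3, m 3, by omega, fun n => ?_⟩
  have e1 : 1 ≤ f n ↔ (n : ℕ) < m 1 := hf.le_apply_iff_val_lt_card 1 n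
  have e2 : 2 ≤ f n ↔ (n : ℕ) < m 2 := hf.le_apply_iff_val_lt_card 2 n
  have e3 : 3 ≤ f n ↔ (n : ℕ) < m 3 := hf.le_apply_iff_val_lt_card 3 n
  have := h3 n
  unfold blockProfile
  split_ifs <;> omega

/-- Sorting an assignment in descending order against ascending weights does not increase the
weighted cost. -/
lemma exists_perm_antitone_sum_mul_le {N : ℕ} {w : Fin N → ℝ} (hw : Monotone w) {q : ℕ → ℝ}
    {s : Set ℕ} (hq : MonotoneOn q s) (f : Fin N → ℕ) (hf : ∀ n, f n ∈ s) :
    ∃ τ : Equiv.Perm (Fin N), Antitone (f ∘ τ) ∧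
      ∑ n, w n * q (f (τ n)) ≤ ∑ n, w n * q (f n) := by
  obtain ⟨τ, hτ⟩ : ∃ τ : Equiv.Perm (Fin N), Antitone (f ∘ τ) :=
    ⟨Tuple.sort (OrderDual.toDual ∘ f), Tuple.monotone_sort (OrderDual.toDual ∘ f)⟩
  refine ⟨τ, hτ, ?_⟩
  have hanti : Antivary w fun n => q (f (τ n)) :=
    hw.antivary fun a b hab => hq (hf _) (hf _) (hτ hab)
  simpa using hanti.sum_mul_le_sum_mul_comp_perm (σ := τ⁻¹)


/-- Paper's Lemma 4: the nonlinear integer program (20-b), minimizing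
`∑ w n * p (g n)` over assignments `g : Fin N → {0,1,2,3}` subject to
`(c/N) * ∑ g n ≥ T`, has the same optimal value as the linear integer program
(27) over block sizes `N₁, N₂, N₃`, where `ws` is the ascending sort of `w`
(witnessed by the permutation `σ`). -/
theorem stmt_4 (N : ℕ) (hN : 0 < N)
    (w ws : Fin N → ℝ) (hw : ∀ n, 0 ≤ w n)
    (σ : Equiv.Perm (Fin N)) (hσ : ∀ n, ws n = w (σ n)) (hmono : Monotone ws)
    (h1 h2 h3 : ℝ) (p : ℝ → ℝ) (hp : ∀ g : ℝ, p g = h1 * g ^ 3 + h2 * g ^ 2 + h3 * g)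
    (hp1 : 0 < p 1) (hp12 : p 1 < p 2) (hp23 : p 2 < p 3)
    (c : ℝ) (hc : 0 < c) (T : ℝ) (hT : T ≤ 3 * c) :
    sInf { v : ℝ | ∃ g : Fin N → ℕ, (∀ n, g n ≤ 3) ∧
        (c / N) * ∑ n, (g n : ℝ) ≥ T ∧ v = ∑ n, w n * p (g n) }
      = sInf { v : ℝ | ∃ N1 N2 N3 : ℕ, N1 + N2 + N3 ≤ N ∧
        (c / N) * ((N1 : ℝ) + 2 * N2 + 3 * N3) ≥ T ∧
        v = p 3 * (∑ n ∈ Finset.univ.filter (fun n : Fin N => (n : ℕ) < N3), ws n)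
          + p 2 * (∑ n ∈ Finset.univ.filter
              (fun n : Fin N => N3 ≤ (n : ℕ) ∧ (n : ℕ) < N3 + N2), ws n)
          + p 1 * (∑ n ∈ Finset.univ.filter
              (fun n : Fin N => N3 + N2 ≤ (n : ℕ) ∧ (n : ℕ) < N3 + N2 + N1), ws n) } := by
  have hp0 : p ((0 : ℕ) : ℝ) = 0 := by simp [hp]
  have hmonoq : MonotoneOn (fun k : ℕ => p k) (Set.Iic 3) := by
    intro a ha b hb hab
    simp only [Set.mem_Iic] at ha hb
    interval_cases b <;> interval_cases a <;> simp only [hp0, Nat.cast_one, Nat.cast_ofNat] <;>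
      linarith
  have hblock := fun N1 N2 N3 => sum_mul_blockProfile N1 N2 N3 ws (fun k => p k) hp0
  simp only [Nat.cast_one, Nat.cast_ofNat] at hblock
  simp only [← hblock]
  set A := { v : ℝ | ∃ g : Fin N → ℕ, (∀ n, g n ≤ 3) ∧
    (c / N) * ∑ n, (g n : ℝ) ≥ T ∧ v = ∑ n, w n * p (g n) }
  set B := { v : ℝ | ∃ N1 N2 N3 : ℕ, N1 + N2 + N3 ≤ N ∧
    (c / N) * ((N1 : ℝ) + 2 * N2 + 3 * N3) ≥ T ∧
    v = ∑ n, ws n * p (blockProfile N1 N2 N3 n) }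
  have hBA : B ⊆ A := by
    rintro v ⟨N1, N2, N3, hle, hfeas, rfl⟩
    refine ⟨fun n => blockProfile N1 N2 N3 (σ.symm n), fun n => blockProfile_le _ _ _ _, ?_, ?_⟩
    · rw [Equiv.sum_comp σ.symm fun n : Fin N => ((blockProfile N1 N2 N3 n : ℕ) : ℝ),
        ← Nat.cast_sum, sum_blockProfile hle]
      push_cast
      exact hfeas
    · rw [← Equiv.sum_comp σ fun n => w n * p (blockProfile N1 N2 N3 (σ.symm n))]
      simp [hσ]
  have hAbdd : BddBelow A := by
    refine ⟨0, ?_⟩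
    rintro v ⟨g, hg, -, rfl⟩
    refine Finset.sum_nonneg fun n _ => mul_nonneg (hw n) ?_
    rw [← hp0]
    exact hmonoq (by simp) (hg n) (Nat.zero_le _)
  have hBne : B.Nonempty := by
    refine ⟨_, 0, 0, N, by simp, ?_, rfl⟩
    have : (N : ℝ) ≠ 0 := by positivity
    have : (c / N) * (((0 : ℕ) : ℝ) + 2 * (0 : ℕ) + 3 * N) = 3 * c := by
      push_cast
      field_simp
      ring
    rw [this]
    exact hT
  refine le_antisymm (csInf_le_csInf hAbdd hBne hBA) (le_csInf (hBne.mono hBA) ?_)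
  rintro v ⟨g, hg, hfeas, rfl⟩
  obtain ⟨τ, hτ, hle⟩ := exists_perm_antitone_sum_mul_le hmono hmonoq (g ∘ σ) fun n => hg (σ n)
  obtain ⟨N1, N2, N3, hN', hf⟩ := hτ.exists_eq_blockProfile fun n => hg (σ (τ n))
  have hsum : ∑ n, (g n : ℝ) = N1 + 2 * N2 + 3 * N3 := by
    rw [← Equiv.sum_comp (τ.trans σ)]
    have : ∀ n, g ((τ.trans σ) n) = blockProfile N1 N2 N3 n := hf
    simp only [this]
    rw [← Nat.cast_sum, sum_blockProfile hN']
    push_cast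
    rfl
  have hmem : ∑ n, ws n * p (blockProfile N1 N2 N3 n) ∈ B :=
    ⟨N1, N2, N3, hN', hsum ▸ hfeas, rfl⟩
  refine (csInf_le (hAbdd.mono hBA) hmem).trans ?_
  have hcost : ∑ n, ws n * p (g (σ n)) = ∑ n, w n * p (g n) := by
    simp only [hσ]
    exact Equiv.sum_comp σ fun n => w n * p (g n)
  rw [← hcost]
  simp only [← hf]
  exact hle
end
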